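/- Let (X,d) be a complete separable metric space in which closed balls are compact, let α be a Young function, and let μ be a probability measure on X. If μ satisfies the transport-entropy inequality T_α(C) for some C > 0, then for every λ ∈ (0,1/C), μ satisfies the (τ)-log-Sobolev inequality (τ)-LSI_α(λ, 1/(1−λC)). -/

import Mathlib

open MeasureTheory Filter Set Topology
open scoped ENNReal NNReal

noncomputable section

/-- The right derivative of a function `α : ℝ → ℝ`. -/
def rightD (α : ℝ → ℝ) (x : ℝ) : ℝ := derivWithin α (Set.Ioi x) x

/-- The left derivative of a function `α : ℝ → ℝ`. -/
def leftD (α : ℝ → ℝ) (x : ℝ) : ℝ := derivWithin α (Set.Iio x) x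

/-- A Young function: an even, convex, nonnegative function, increasing on `[0,∞)`,
vanishing at `0` and with vanishing right derivative at `0`. -/
structure IsYoung (α : ℝ → ℝ) : Prop where
  nonneg : ∀ x, 0 ≤ α x
  even : ∀ x, α (-x) = α x
  convex : ConvexOn ℝ Set.univ α
  mono : StrictMonoOn α (Set.Ici 0)
  zero : α 0 = 0
  rightD_zero : rightD α 0 = 0

/-- The Δ₂-condition for a Young function. -/
def DeltaTwo (α : ℝ → ℝ) : Prop := ∃ K > 0, ∀ x : ℝ, α (2 * x) ≤ K * α x

/-- `r_α = inf_{x>0} x α'₋(x)/α(x)`. -/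
def rAlpha (α : ℝ → ℝ) : ℝ := sInf {r : ℝ | ∃ x > 0, r = x * leftD α x / α x}

/-- `p_α = sup_{x>0} x α'₊(x)/α(x)`. -/
def pAlpha (α : ℝ → ℝ) : ℝ := sSup {r : ℝ | ∃ x > 0, r = x * rightD α x / α x}

/-- The Fenchel-Legendre transform `α*(y) = sup_x {xy - α(x)}`, with values in `[0,∞]`. -/
def legendre (α : ℝ → ℝ) (y : ℝ) : ℝ≥0∞ := ⨆ x : ℝ, ENNReal.ofReal (x * y - α x)

/-- `ξ_α(t) = sup_{u>0} α*(t α'₊(u)) / (t α(u))`. -/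
def xiAlpha (α : ℝ → ℝ) (t : ℝ) : ℝ≥0∞ :=
  ⨆ u : {u : ℝ // 0 < u}, legendre α (t * rightD α u) / ENNReal.ofReal (t * α u)

/-- A bounded real-valued function. -/
def IsBoundedFun {Y : Type*} (f : Y → ℝ) : Prop := ∃ M, ∀ x, |f x| ≤ M

variable {X : Type*} [MetricSpace X] [MeasurableSpace X]

/-- The optimal transport cost `T_α(ν,μ)` between two measures, for the cost
function `(x,y) ↦ α(d(x,y))`. -/
def transportCost (α : ℝ → ℝ) (ν μ : Measure X) : ℝ≥0∞ :=
  sInf { c : ℝ≥0∞ | ∃ π : Measure (X × X), π.map Prod.fst = ν ∧ π.map Prod.snd = μ ∧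
      c = ∫⁻ z, ENNReal.ofReal (α (dist z.1 z.2)) ∂π }

open Classical in
/-- The relative entropy `H(ν|μ) = ∫ log (dν/dμ) dν` if `ν ≪ μ` (and `+∞` if `ν` is not
absolutely continuous with respect to `μ`, or if the integral diverges). -/
def relEnt (ν μ : Measure X) : ℝ≥0∞ :=
  if ν ≪ μ ∧ Integrable (fun x => Real.log (ν.rnDeriv μ x).toReal) ν
  then ENNReal.ofReal (∫ x, Real.log (ν.rnDeriv μ x).toReal ∂ν) else ⊤

/-- The transport-entropy inequality `T_α(C)`: for every probability measure `ν`,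
`T_α(ν,μ) ≤ C H(ν|μ)`. -/
def TransportEntropy (μ : Measure X) (α : ℝ → ℝ) (C : ℝ) : Prop :=
  ∀ ν : Measure X, IsProbabilityMeasure ν →
    transportCost α ν μ ≤ ENNReal.ofReal C * relEnt ν μ

/-- The entropy functional `Ent_μ(e^f)`. -/
def entExp (μ : Measure X) (f : X → ℝ) : ℝ :=
  ∫ x, Real.exp (f x) * Real.log (Real.exp (f x)) ∂μ
    - (∫ x, Real.exp (f x) ∂μ) * Real.log (∫ x, Real.exp (f x) ∂μ)

/-- `|∇⁺ f|(x) = limsup_{y → x} [f(y) - f(x)]₊ / d(y,x)` (equal to `0` at isolated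
points by the conventions on `limsup` and `sInf` in `ℝ`). -/
def gradPlus (f : X → ℝ) (x : X) : ℝ :=
  limsup (fun y => max (f y - f x) 0 / dist y x) (𝓝[≠] x)

/-- `|∇⁻ f|(x) = limsup_{y → x} [f(y) - f(x)]₋ / d(y,x)` (equal to `0` at isolated
points by the conventions on `limsup` and `sInf` in `ℝ`). -/
def gradMinus (f : X → ℝ) (x : X) : ℝ :=
  limsup (fun y => max (-(f y - f x)) 0 / dist y x) (𝓝[≠] x)

/-- The modified log-Sobolev inequality plus `LSI⁺_α(A)`. -/
def LSIplus (μ : Measure X) (α : ℝ → ℝ) (A : ℝ) : Prop :=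
  ∀ f : X → ℝ, IsBoundedFun f → LocallyLipschitz f →
    ENNReal.ofReal (entExp μ f) ≤
      ENNReal.ofReal A * ∫⁻ x, legendre α (gradPlus f x) * ENNReal.ofReal (Real.exp (f x)) ∂μ

/-- The modified log-Sobolev inequality minus `LSI⁻_α(A)`. -/
def LSIminus (μ : Measure X) (α : ℝ → ℝ) (A : ℝ) : Prop :=
  ∀ f : X → ℝ, IsBoundedFun f → LocallyLipschitz f →
    ENNReal.ofReal (entExp μ f) ≤
      ENNReal.ofReal A * ∫⁻ x, legendre α (gradMinus f x) * ENNReal.ofReal (Real.exp (f x)) ∂μ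

/-- The inf-convolution operator `Q_α^λ f(x) = inf_y {f(y) + λ α(d(x,y))}`. -/
def QInf (α : ℝ → ℝ) (lam : ℝ) (f : X → ℝ) (x : X) : ℝ :=
  ⨅ y : X, (f y + lam * α (dist x y))

/-- The `(τ)`-log-Sobolev inequality `(τ)-LSI_α(λ, A)`. -/
def TauLSI (μ : Measure X) (α : ℝ → ℝ) (lam A : ℝ) : Prop :=
  ∀ f : X → ℝ, IsBoundedFun f → LocallyLipschitz f →
    entExp μ f ≤ A * ∫ x, (f x - QInf α lam f x) * Real.exp (f x) ∂μ

/-- The `n`-dimensional inf-convolution operator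
`Q_{α,n} f(x) = inf_y {f(y) + Σᵢ α(d(xᵢ,yᵢ))}`. -/
def QInfN (α : ℝ → ℝ) {n : ℕ} (f : (Fin n → X) → ℝ) (x : Fin n → X) : ℝ :=
  ⨅ y : Fin n → X, (f y + ∑ i, α (dist (x i) (y i)))

/-- The `n`-dimensional sup-convolution operator
`P_{α,n} f(x) = sup_y {f(y) - Σᵢ α(d(xᵢ,yᵢ))}`. -/
def PSupN (α : ℝ → ℝ) {n : ℕ} (f : (Fin n → X) → ℝ) (x : Fin n → X) : ℝ :=
  ⨆ y : Fin n → X, (f y - ∑ i, α (dist (x i) (y i)))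

end


theorem IsYoung.continuous {α : ℝ → ℝ} (hα : IsYoung α) : Continuous α :=
  hα.convex.locallyLipschitz.continuous

theorem ofReal_integral_le_lintegral_ofReal {Ω : Type*} [MeasurableSpace Ω] {μ : Measure Ω}
    {φ : Ω → ℝ} (hφ : Integrable φ μ) :
    ENNReal.ofReal (∫ x, φ x ∂μ) ≤ ∫⁻ x, ENNReal.ofReal (φ x) ∂μ := by
  apply ENNReal.ofReal_le_of_le_toReal
  rw [integral_eq_lintegral_pos_part_sub_lintegral_neg_part hφ]
  exact sub_le_self _ ENNReal.toReal_nonneg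

/-- Integrability of a bounded measurable function against a finite measure. -/
theorem IsBoundedFun.integrable {Ω : Type*} [MeasurableSpace Ω] {μ : Measure Ω}
    [IsFiniteMeasure μ] {φ : Ω → ℝ} (hb : IsBoundedFun φ) (hφ : Measurable φ) :
    Integrable φ μ := by
  obtain ⟨M, hM⟩ := hb
  exact Integrable.of_bound hφ.aestronglyMeasurable M (Eventually.of_forall hM)

section QInf

variable {X : Type*} [MetricSpace X] {α : ℝ → ℝ} {lam : ℝ} {f : X → ℝ}

theorem bddBelow_range_QInf (hα : ∀ x, 0 ≤ α x) (hlam : 0 ≤ lam) (hf : IsBoundedFun f) (x : X) :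
    BddBelow (range fun y => f y + lam * α (dist x y)) := by
  obtain ⟨M, hM⟩ := hf
  refine ⟨-M, ?_⟩
  rintro _ ⟨y, rfl⟩
  have := (abs_le.1 (hM y)).1
  have := mul_nonneg hlam (hα (dist x y))
  dsimp only
  linarith

theorem QInf_le (hα : ∀ x, 0 ≤ α x) (hlam : 0 ≤ lam) (hf : IsBoundedFun f) (x y : X) :
    QInf α lam f x ≤ f y + lam * α (dist x y) :=
  ciInf_le (bddBelow_range_QInf hα hlam hf x) y

theorem QInf_le_self (hα : IsYoung α) (hlam : 0 ≤ lam) (hf : IsBoundedFun f) (x : X) :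
    QInf α lam f x ≤ f x := by
  simpa [hα.zero] using QInf_le hα.nonneg hlam hf x x

theorem isBoundedFun_QInf (hα : IsYoung α) (hlam : 0 ≤ lam) (hf : IsBoundedFun f) :
    IsBoundedFun (QInf α lam f) := by
  obtain ⟨M, hM⟩ := id hf
  refine ⟨M, fun x => abs_le.2 ⟨?_, (QInf_le_self hα hlam hf x).trans (abs_le.1 (hM x)).2⟩⟩
  have : Nonempty X := ⟨x⟩
  refine le_ciInf fun y => ?_
  have := (abs_le.1 (hM y)).1
  have := mul_nonneg hlam (hα.nonneg (dist x y))
  linarith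

theorem measurable_QInf [MeasurableSpace X] [BorelSpace X] (hα : IsYoung α) (hlam : 0 ≤ lam)
    (hf : IsBoundedFun f) : Measurable (QInf α lam f) := by
  refine UpperSemicontinuous.measurable (upperSemicontinuous_ciInf
    (bddBelow_range_QInf hα.nonneg hlam hf) fun y => Continuous.upperSemicontinuous ?_)
  have := hα.continuous
  fun_prop

end QInf

/-- The easy half of Kantorovich duality, for the admissible pair `(Q f, f)`. -/
theorem ofReal_integral_QInf_sub_le_transportCost {X : Type*} [MetricSpace X] [MeasurableSpace X]
    [BorelSpace X] {α : ℝ → ℝ} {lam : ℝ} {f : X → ℝ} (hα : IsYoung α) (hlam : 0 < lam)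
    (hf : IsBoundedFun f) (hfm : Measurable f) (ν μ : Measure X) [IsProbabilityMeasure ν] :
    ENNReal.ofReal ((∫ x, QInf α lam f x ∂ν - ∫ x, f x ∂μ) / lam) ≤ transportCost α ν μ := by
  refine le_sInf ?_
  rintro c ⟨π, hπν, hπμ, rfl⟩
  have hπ : IsProbabilityMeasure (π.map Prod.fst) := by rw [hπν]; infer_instance
  have : IsProbabilityMeasure π := Measure.isProbabilityMeasure_of_map Prod.fst
  have : IsFiniteMeasure μ := by rw [← hπμ]; infer_instance
  have hQm := measurable_QInf hα hlam.le hf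
  have hQi : Integrable (QInf α lam f) ν := (isBoundedFun_QInf hα hlam.le hf).integrable hQm
  have hfi : Integrable f μ := hf.integrable hfm
  rw [← hπν] at hQi ⊢
  rw [← hπμ] at hfi ⊢
  rw [integral_map measurable_fst.aemeasurable hQm.aestronglyMeasurable,
    integral_map measurable_snd.aemeasurable hfm.aestronglyMeasurable]
  have hQi' : Integrable (fun z : X × X => QInf α lam f z.1) π :=
    hQi.comp_measurable measurable_fst
  have hfi' : Integrable (fun z : X × X => f z.2) π := hfi.comp_measurable measurable_snd
  rw [← integral_sub hQi' hfi', ← integral_div]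
  refine (ofReal_integral_le_lintegral_ofReal ((hQi'.sub hfi').div_const lam)).trans
    (lintegral_mono fun z => ENNReal.ofReal_le_ofReal ?_)
  rw [div_le_iff₀ hlam]
  have := QInf_le hα.nonneg hlam.le hf z.1 z.2
  simp only [Pi.sub_apply]
  linarith

section ExponentialTilt

variable {X : Type*} [MeasurableSpace X] {f : X → ℝ} {μ : Measure X}

theorem integral_mul_exp_eq_integral_tilted [NeZero μ]
    (hfe : Integrable (fun x => Real.exp (f x)) μ)
    (g : X → ℝ) :
    ∫ x, g x * Real.exp (f x) ∂μ = (∫ x, Real.exp (f x) ∂μ) * ∫ x, g x ∂(μ.tilted f) := by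
  have hZ := integral_exp_pos hfe
  rw [integral_tilted, ← integral_const_mul]
  refine integral_congr_ae (Eventually.of_forall fun x => ?_)
  simp only [smul_eq_mul]
  field_simp

theorem entExp_eq_mul_integral_tilted [MetricSpace X] [NeZero μ]
    (hfe : Integrable (fun x => Real.exp (f x)) μ) :
    entExp μ f = (∫ x, Real.exp (f x) ∂μ) *
      (∫ x, f x ∂(μ.tilted f) - Real.log (∫ x, Real.exp (f x) ∂μ)) := by
  rw [mul_sub, ← integral_mul_exp_eq_integral_tilted hfe, entExp]
  simp only [Real.log_exp, mul_comm]

theorem relEnt_tilted [MetricSpace X] [SigmaFinite μ] [NeZero μ]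
    (hfe : Integrable (fun x => Real.exp (f x)) μ)
    (hf : Integrable f (μ.tilted f)) :
    relEnt (μ.tilted f) μ = ENNReal.ofReal
      (∫ x, f x ∂(μ.tilted f) - Real.log (∫ x, Real.exp (f x) ∂μ)) := by
  have := isProbabilityMeasure_tilted hfe
  have hac := tilted_absolutelyContinuous μ f
  have hlog := hac.ae_eq (log_rnDeriv_tilted_left_self hfe)
  have hint : Integrable (fun x => f x - Real.log (∫ x, Real.exp (f x) ∂μ)) (μ.tilted f) :=
    hf.sub (integrable_const _)
  rw [relEnt, if_pos ⟨hac, hint.congr hlog.symm⟩, integral_congr_ae hlog,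
    integral_sub hf (integrable_const _)]
  simp

theorem integral_le_log_integral_exp [IsProbabilityMeasure μ]
    (hfe : Integrable (fun x => Real.exp (f x)) μ)
    (hf : Integrable f μ) :
    ∫ x, f x ∂μ ≤ Real.log (∫ x, Real.exp (f x) ∂μ) := by
  rw [Real.le_log_iff_exp_le (integral_exp_pos hfe)]
  exact convexOn_exp.map_integral_le Real.continuous_exp.continuousOn isClosed_univ
    (by simp) hf hfe

end ExponentialTilt

theorem transport_entropy_implies_tau_lsi
    {X : Type*} [MetricSpace X] [CompleteSpace X] [TopologicalSpace.SeparableSpace X]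
    [ProperSpace X] [MeasurableSpace X] [BorelSpace X]
    (α : ℝ → ℝ) (hα : IsYoung α)
    (μ : Measure X) [IsProbabilityMeasure μ] (C : ℝ) (hC : 0 < C)
    (hT : TransportEntropy μ α C) :
    ∀ lam : ℝ, 0 < lam → lam < 1 / C → TauLSI μ α lam (1 / (1 - lam * C)) := by
  intro lam hlam hlamC f hf hfl
  have hfm : Measurable f := hfl.continuous.measurable
  have hfe : Integrable (fun x => Real.exp (f x)) μ := by
    obtain ⟨M, hM⟩ := id hf
    refine IsBoundedFun.integrable ⟨Real.exp M, fun x => ?_⟩ hfm.exp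
    rw [Real.abs_exp]
    exact Real.exp_le_exp.2 (abs_le.1 (hM x)).2
  have hZ := integral_exp_pos hfe
  have hden : 0 < 1 - lam * C := by
    rw [lt_div_iff₀ hC] at hlamC
    linarith
  have := isProbabilityMeasure_tilted hfe
  have hfν : Integrable f (μ.tilted f) := hf.integrable hfm
  have hQν : Integrable (QInf α lam f) (μ.tilted f) :=
    (isBoundedFun_QInf hα hlam.le hf).integrable (measurable_QInf hα hlam.le hf)
  have hJ := integral_le_log_integral_exp hfe (hf.integrable hfm)
  have hQf : ∫ x, QInf α lam f x ∂(μ.tilted f) ≤ ∫ x, f x ∂(μ.tilted f) :=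
    integral_mono hQν hfν (QInf_le_self hα hlam.le hf)
  have hcost := (ofReal_integral_QInf_sub_le_transportCost hα hlam hf hfm (μ.tilted f) μ).trans
    (hT (μ.tilted f) inferInstance)
  rw [relEnt_tilted hfe hfν, ← ENNReal.ofReal_mul hC.le] at hcost
  rw [entExp_eq_mul_integral_tilted hfe, integral_mul_exp_eq_integral_tilted hfe,
    integral_sub hfν hQν, mul_left_comm]
  refine mul_le_mul_of_nonneg_left ?_ hZ.le
  rw [one_div, inv_mul_eq_div, le_div_iff₀ hden]
  set H := ∫ x, f x ∂(μ.tilted f) - Real.log (∫ x, Real.exp (f x) ∂μ)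
  rcases le_or_gt H 0 with h | h
  · have := mul_nonpos_of_nonpos_of_nonneg h hden.le
    linarith
  · rw [ENNReal.ofReal_le_ofReal_iff (by positivity), div_le_iff₀ hlam] at hcost
    linarith
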